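/- Let f : ℝ → ℝ be smooth with f and f' linearly independent, and suppose P and Q are two weighted-homogeneous polynomials in ℝ[u_0, ..., u_{d-1}] of weighted degree d ≥ 1 (with wd(u_j) = j+1), both satisfying the linear equation e_{-̄1}e_{-1}X + f'·X = 0 (equivalently Σ_j T^j ∂_{u_j}(e_{-1}X) = f'·X), and both having the same coefficient of u_{d-1}. Then P = Q. -/

import Mathlib

open MvPolynomial

/-- The coefficient ring C^∞-functions of u (modelled as all functions ℝ → ℝ,
with the relevant functions required smooth in the hypotheses). -/
abbrev SF : Type := ℝ → ℝ

/-- The ring R = C^∞(ℝ)[u₀, u₁, u₂, ...]: polynomials in the formal variables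
u_j (j : ℕ) with function coefficients. -/
abbrev RR : Type := MvPolynomial ℕ SF

/-- The operator ∂/∂u, differentiating the coefficient functions. -/
noncomputable def du (p : RR) : RR :=
  ∑ m ∈ p.support, monomial m (deriv (MvPolynomial.coeff m p))

/-- The total derivative e₋₁ = u₀·∂/∂u + Σ_i u_{i+1}·∂/∂u_i
(a finite sum on any polynomial). -/
noncomputable def eneg1 (p : RR) : RR :=
  X 0 * du p + ∑ i ∈ p.vars, X (i + 1) * pderiv i p

/-- T^j = (e₋₁)^j f. -/
noncomputable def Tf (f : SF) (j : ℕ) : RR := eneg1^[j] (MvPolynomial.C f)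

/-- The recursively defined T^i: T⁰ = f, T^{i+1} = Σ_{j=0}^{i} C(i,j)·u_{i-j}·(T^j)_u. -/
noncomputable def Trec (f : SF) : ℕ → RR
  | 0 => MvPolynomial.C f
  | (i + 1) => ∑ j ∈ (Finset.range (i + 1)).attach,
      (Nat.choose i j.1 : RR) * (X (i - j.1) * du (Trec f j.1))
  decreasing_by exact Finset.mem_range.mp j.2

/-- The operator Σ_{j≥0} T^j·∂/∂u_j = f·∂/∂u₀ + Σ_{j≥1} T^j·∂/∂u_j
(equal to -e_{-̄1} on polynomials in the u_j). -/
noncomputable def Ebar (f : SF) (p : RR) : RR :=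
  ∑ j ∈ p.vars, Tf f j * pderiv j p

/-- Inclusion of ℝ[u₀, u₁, ...] (constant coefficients) into R. -/
noncomputable def constLift : MvPolynomial ℕ ℝ →+* RR :=
  MvPolynomial.map (algebraMap ℝ SF)

/-- Weighted degree of a monomial, determined by wd(u_j) = j + 1. -/
def wdeg (m : ℕ →₀ ℕ) : ℕ := m.sum fun j e => e * (j + 1)

/-- The constant polynomial with constant value r. -/
noncomputable def Cc (r : ℝ) : RR := MvPolynomial.C (fun _ : ℝ => r)

lemma aux_pderiv_comm {R : Type*} [CommRing R] (i j : ℕ) (p : MvPolynomial ℕ R) :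
    pderiv i (pderiv j p) = pderiv j (pderiv i p) := by
  ext m
  rw [coeff_pderiv, coeff_pderiv, coeff_pderiv, coeff_pderiv, add_right_comm]
  by_cases h : i = j
  · subst h; rfl
  · have h' : j ≠ i := fun e => h e.symm
    simp only [Finsupp.add_apply, Finsupp.single_apply, if_neg h, if_neg h', add_zero]
    ring

lemma aux_sum (g : ℕ → RR) (p : RR) (M : ℕ) (h : ∀ k, M ≤ k → pderiv k p = 0) :
    ∑ i ∈ p.vars, g i * pderiv i p = ∑ i ∈ Finset.range M, g i * pderiv i p := by
  classical
  have h1 : ∑ i ∈ p.vars, g i * pderiv i p = ∑ i ∈ p.vars ∪ Finset.range M, g i * pderiv i p := by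
    apply Finset.sum_subset Finset.subset_union_left
    intro i _ hi
    rw [pderiv_eq_zero_of_notMem_vars hi, mul_zero]
  have h2 : ∑ i ∈ Finset.range M, g i * pderiv i p
      = ∑ i ∈ p.vars ∪ Finset.range M, g i * pderiv i p := by
    apply Finset.sum_subset Finset.subset_union_right
    intro i _ hi
    rw [h i (by simpa using hi), mul_zero]
  rw [h1, h2]

lemma aux_du_coeff (p : RR) (m : ℕ →₀ ℕ) : coeff m (du p) = deriv (coeff m p) := by
  classical
  unfold du
  rw [coeff_sum]
  simp only [coeff_monomial]
  rw [Finset.sum_ite_eq' p.support m]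
  split_ifs with h
  · rfl
  · rw [notMem_support_iff.mp h]
    funext x
    exact (deriv_const x (0:ℝ)).symm

lemma aux_du_pderiv (p : RR) (i : ℕ) (h : pderiv i p = 0) : pderiv i (du p) = 0 := by
  ext1 m
  have h1 := congrArg (coeff m) h
  rw [coeff_pderiv, coeff_zero] at h1
  have h2 : coeff (m + Finsupp.single i 1) p = 0 := by
    funext x
    have := congrFun h1 x
    simp only [Pi.mul_apply, Pi.zero_apply, Pi.add_apply, Pi.one_apply, Pi.natCast_apply] at this
    rcases mul_eq_zero.mp this with h3 | h3
    · exact h3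
    · exfalso
      have : (0:ℝ) < (m i : ℝ) + 1 := by positivity
      linarith
  rw [coeff_pderiv, aux_du_coeff, h2, coeff_zero]
  have : deriv (0 : SF) = 0 := by
    funext x
    exact deriv_const x (0:ℝ)
  rw [this, zero_mul]

lemma aux_du_C (f : SF) : du (C f) = C (deriv f) := by
  classical
  ext1 m
  rw [aux_du_coeff, coeff_C, coeff_C]
  split_ifs
  · rfl
  · funext x
    exact deriv_const x (0:ℝ)

lemma aux_eneg (p : RR) (M : ℕ) (h : ∀ k, M ≤ k → pderiv k p = 0) :
    eneg1 p = X 0 * du p + ∑ i ∈ Finset.range M, X (i + 1) * pderiv i p := by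
  unfold eneg1
  rw [aux_sum _ p M h]

lemma aux_Tf_succ (f : SF) (j : ℕ) : Tf f (j + 1) = eneg1 (Tf f j) := by
  unfold Tf
  rw [Function.iterate_succ_apply']

lemma aux_T_free (f : SF) (j : ℕ) : ∀ k, j ≤ k → pderiv k (Tf f j) = 0 := by
  induction j with
  | zero => intro k _; simp [Tf]
  | succ j ih =>
    intro k hk
    rw [aux_Tf_succ, aux_eneg _ j ih, map_add, map_sum, pderiv_mul,
      aux_du_pderiv _ k (ih k (by omega)), pderiv_X_of_ne (by omega), zero_mul, mul_zero, add_zero,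
      zero_add]
    apply Finset.sum_eq_zero
    intro i hi
    rw [Finset.mem_range] at hi
    rw [pderiv_mul, pderiv_X_of_ne (by omega), aux_pderiv_comm, ih k (by omega)]
    simp

lemma aux_T_top (f : SF) (j : ℕ) : pderiv j (Tf f (j + 1)) = C (deriv f) := by
  induction j with
  | zero =>
    rw [aux_Tf_succ, aux_eneg _ 0 (aux_T_free f 0)]
    simp [Tf, aux_du_C]
  | succ j ih =>
    rw [aux_Tf_succ, aux_eneg _ (j + 1) (aux_T_free f (j + 1)), map_add, map_sum, pderiv_mul,
      aux_du_pderiv _ _ (aux_T_free f (j + 1) _ le_rfl), pderiv_X_of_ne (by omega), zero_mul,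
      mul_zero, add_zero, zero_add, Finset.sum_range_succ, Finset.sum_eq_zero, zero_add,
      pderiv_mul, pderiv_X_self, aux_pderiv_comm, aux_T_free f (j + 1) _ le_rfl, ih]
    · simp
    · intro i hi
      rw [Finset.mem_range] at hi
      rw [pderiv_mul, pderiv_X_of_ne (by omega), aux_pderiv_comm, aux_T_free f (j + 1) _ le_rfl]
      simp

lemma aux_T_const (f : SF) (j : ℕ) : constantCoeff (Tf f (j + 1)) = 0 := by
  rw [aux_Tf_succ]
  unfold eneg1
  rw [map_add, map_sum]
  simp

lemma aux_Ebar (f : SF) (p : RR) (M : ℕ) (h : ∀ k, M ≤ k → pderiv k p = 0) :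
    Ebar f p = ∑ j ∈ Finset.range M, Tf f j * pderiv j p := aux_sum _ p M h

lemma aux_bound (p : RR) : ∃ M, ∀ k, M ≤ k → pderiv k p = 0 := by
  refine ⟨p.vars.sup id + 1, fun k hk => pderiv_eq_zero_of_notMem_vars fun hmem => ?_⟩
  have := Finset.le_sup (f := id) hmem
  simp only [id] at this
  omega

lemma aux_Ebar_sub (f : SF) (p q : RR) : Ebar f (p - q) = Ebar f p - Ebar f q := by
  obtain ⟨M, hM⟩ := aux_bound p
  obtain ⟨N, hN⟩ := aux_bound q
  have hp : ∀ k, max M N ≤ k → pderiv k p = 0 := fun k hk => hM k (le_trans (le_max_left _ _) hk)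
  have hq : ∀ k, max M N ≤ k → pderiv k q = 0 := fun k hk => hN k (le_trans (le_max_right _ _) hk)
  rw [aux_Ebar f p _ hp, aux_Ebar f q _ hq, aux_Ebar f (p - q) (max M N)
    (fun k hk => by rw [map_sub, hp k hk, hq k hk, sub_zero]), ← Finset.sum_sub_distrib]
  simp only [map_sub, mul_sub]

/-- Commutation with a top-order partial derivative. -/
lemma aux_pderiv_Ebar (f : SF) (p : RR) (M k : ℕ) (h : ∀ l, M ≤ l → pderiv l p = 0) :
    pderiv k (Ebar f p) = (∑ j ∈ Finset.range M, pderiv k (Tf f j) * pderiv j p)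
      + Ebar f (pderiv k p) := by
  rw [aux_Ebar f p M h, aux_Ebar f (pderiv k p) M
    (fun l hl => by rw [aux_pderiv_comm, h l hl, map_zero]), map_sum, ← Finset.sum_add_distrib]
  refine Finset.sum_congr rfl fun j _ => ?_
  rw [pderiv_mul, aux_pderiv_comm k j]

lemma aux_Ebar_top (f : SF) (p : RR) (N : ℕ) (h : ∀ l, N + 1 ≤ l → pderiv l p = 0) :
    pderiv N (Ebar f p) = Ebar f (pderiv N p) := by
  rw [aux_pderiv_Ebar f p (N + 1) N h, Finset.sum_eq_zero, zero_add]
  intro j hj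
  rw [Finset.mem_range] at hj
  rw [aux_T_free f j N (by omega), zero_mul]

lemma aux_Ebar_const (f : SF) (p : RR) :
    constantCoeff (Ebar f p) = f * constantCoeff (pderiv 0 p) := by
  obtain ⟨M, hM⟩ := aux_bound p
  rw [aux_Ebar f p (M + 1) (fun k hk => hM k (by omega)), map_sum, Finset.sum_range_succ',
    Finset.sum_eq_zero, zero_add, map_mul]
  · simp [Tf]
  · intro i _
    rw [map_mul, aux_T_const, zero_mul]

lemma aux_lift_pderiv (A : MvPolynomial ℕ ℝ) (i : ℕ) :
    pderiv i (constLift A) = constLift (pderiv i A) := pderiv_map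

lemma aux_lift_inj (A B : MvPolynomial ℕ ℝ) (h : constLift A = constLift B) : A = B := by
  refine map_injective (algebraMap ℝ SF) ?_ h
  exact (algebraMap ℝ SF).injective

lemma aux_du_lift (A : MvPolynomial ℕ ℝ) : du (constLift A) = 0 := by
  ext1 m
  rw [aux_du_coeff, constLift, coeff_map, coeff_zero]
  funext x
  exact deriv_const x (coeff m A)

lemma aux_deg (A : MvPolynomial ℕ ℝ) (i n : ℕ) (h : A.totalDegree ≤ n + 1) :
    (pderiv i A).totalDegree ≤ n := by
  refine Finset.sup_le fun m hm => ?_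
  rw [mem_support_iff, coeff_pderiv] at hm
  have h1 := le_totalDegree (mem_support_iff.mpr (left_ne_zero_of_mul hm))
  rw [Finsupp.sum_add_index' (fun _ => rfl) (fun _ _ _ => rfl),
    Finsupp.sum_single_index rfl] at h1
  omega

lemma aux_pderiv_ne (A : MvPolynomial ℕ ℝ) (N : ℕ) (h : N ∈ A.vars) : pderiv N A ≠ 0 := by
  intro h0
  obtain ⟨m, hm, hN⟩ := (mem_vars_iff_mem_support N).mp h
  have h1 := congrArg (coeff (m - Finsupp.single N 1)) h0
  have hle : Finsupp.single N 1 ≤ m := by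
    rw [Finsupp.single_le_iff]
    exact Nat.one_le_iff_ne_zero.mpr (Finsupp.mem_support_iff.mp hN)
  rw [coeff_pderiv, tsub_add_cancel_of_le hle, coeff_zero] at h1
  rcases mul_eq_zero.mp h1 with h2 | h2
  · exact (mem_support_iff.mp hm) h2
  · have : (0:ℝ) < ((m - Finsupp.single N 1 : ℕ →₀ ℕ) N : ℝ) + 1 := by positivity
    linarith

lemma aux_max (A : MvPolynomial ℕ ℝ) (h : A.vars.Nonempty) :
    ∃ N ∈ A.vars, ∀ l, N + 1 ≤ l → pderiv l A = 0 := by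
  refine ⟨A.vars.max' h, Finset.max'_mem _ _, fun l hl => pderiv_eq_zero_of_notMem_vars fun hm => ?_⟩
  have := Finset.le_max' _ _ hm
  omega

lemma aux_C_of_vars (A : MvPolynomial ℕ ℝ) (h : ¬ A.vars.Nonempty) : ∃ c, A = C c := by
  rw [Finset.not_nonempty_iff_eq_empty] at h
  exact ⟨_, vars_eq_empty_iff_eq_C.mp h⟩

/-- Kernel lemma. -/
lemma aux_kernel (f : SF) (hli : ∀ a b : ℝ, a • f + b • deriv f = 0 → a = 0 ∧ b = 0) (n : ℕ) :
    ∀ A : MvPolynomial ℕ ℝ, A.totalDegree ≤ n → Ebar f (constLift A) = 0 → ∃ c, A = C c := by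
  induction n with
  | zero =>
    intro A hA _
    exact ⟨_, totalDegree_eq_zero_iff_eq_C.mp (Nat.le_zero.mp hA)⟩
  | succ n ih =>
    intro A hA hE
    by_cases hv : A.vars.Nonempty
    swap
    · exact aux_C_of_vars A hv
    obtain ⟨N, hN, hfree⟩ := aux_max A hv
    have hfree' : ∀ l, N + 1 ≤ l → pderiv l (constLift A) = 0 := fun l hl => by
      rw [aux_lift_pderiv, hfree l hl, map_zero]
    exfalso
    have h1 := aux_Ebar_top f _ N hfree'
    rw [hE, map_zero, aux_lift_pderiv] at h1
    obtain ⟨c, hc⟩ := ih _ (aux_deg A N n hA) h1.symm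
    apply aux_pderiv_ne A N hN
    have key : c = 0 := by
      rcases N with _ | N
      · have h2 := aux_Ebar_const f (constLift A)
        rw [hE, aux_lift_pderiv, hc] at h2
        refine (hli c 0 ?_).1
        rw [zero_smul, add_zero]
        funext x
        have := congrFun h2 x
        simp [constLift] at this
        simp only [Pi.smul_apply, smul_eq_mul, Pi.zero_apply, mul_eq_zero]
        tauto
      · have h2 := aux_pderiv_Ebar f (constLift A) (N + 2) N hfree'
        rw [hE, map_zero, Finset.sum_range_succ, Finset.sum_range_succ, aux_T_top,
          aux_lift_pderiv, aux_lift_pderiv, hc, aux_T_free f N N le_rfl,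
          Finset.sum_eq_zero, zero_mul] at h2
        · have h3 := congrArg constantCoeff h2
          rw [map_add, aux_Ebar_const, aux_lift_pderiv] at h3
          refine (hli (constantCoeff (pderiv 0 (pderiv N A))) c ?_).2
          funext x
          have := congrFun h3 x
          simp [constLift, constantCoeff_map] at this
          simp only [Pi.add_apply, Pi.smul_apply, smul_eq_mul, Pi.zero_apply]
          linarith
        · intro j hj
          rw [Finset.mem_range] at hj
          rw [aux_T_free f j N (by omega), zero_mul]
    rw [hc, key, C_0]

lemma aux_eneg_lift (A : MvPolynomial ℕ ℝ) (M : ℕ) (h : ∀ k, M ≤ k → pderiv k A = 0) :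
    eneg1 (constLift A) = constLift (∑ i ∈ Finset.range M, X (i + 1) * pderiv i A) := by
  rw [aux_eneg _ M (fun k hk => by rw [aux_lift_pderiv, h k hk, map_zero]), aux_du_lift, mul_zero,
    zero_add, map_sum]
  refine Finset.sum_congr rfl fun i _ => ?_
  rw [map_mul, aux_lift_pderiv]
  simp [constLift]

/-- The top-order partial derivative of a solution is constant. -/
lemma aux_main (f : SF) (hli : ∀ a b : ℝ, a • f + b • deriv f = 0 → a = 0 ∧ b = 0)
    (A : MvPolynomial ℕ ℝ) (N : ℕ) (hfree : ∀ l, N + 1 ≤ l → pderiv l A = 0)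
    (hE : Ebar f (eneg1 (constLift A)) = C (deriv f) * constLift A) :
    ∃ c, pderiv N A = C c := by
  rw [aux_eneg_lift A (N + 1) hfree] at hE
  set Z := ∑ i ∈ Finset.range (N + 1), X (i + 1) * pderiv i A with hZ
  have hZf : ∀ l, N + 1 + 1 ≤ l → pderiv l Z = 0 := by
    intro l hl
    rw [hZ, map_sum]
    apply Finset.sum_eq_zero
    intro i hi
    rw [Finset.mem_range] at hi
    rw [pderiv_mul, pderiv_X_of_ne (by omega), aux_pderiv_comm, hfree l (by omega)]
    simp
  have hZt : pderiv (N + 1) Z = pderiv N A := by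
    rw [hZ, map_sum, Finset.sum_range_succ, Finset.sum_eq_zero, zero_add, pderiv_mul,
      pderiv_X_self, aux_pderiv_comm, hfree _ le_rfl]
    · simp
    · intro i hi
      rw [Finset.mem_range] at hi
      rw [pderiv_mul, pderiv_X_of_ne (by omega), aux_pderiv_comm, hfree _ le_rfl]
      simp
  have h1 := aux_Ebar_top f (constLift Z) (N + 1)
    (fun l hl => by rw [aux_lift_pderiv, hZf l hl, map_zero])
  rw [hE, pderiv_C_mul, aux_lift_pderiv, aux_lift_pderiv, hfree _ le_rfl, hZt, map_zero,
    mul_zero] at h1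
  exact aux_kernel f hli _ _ le_rfl h1.symm

/-- Uniqueness (dim V_d ≤ 1): if f and f' are linearly independent and P, Q are
weighted-homogeneous polynomials in ℝ[u₀, ..., u_{d-1}] of weighted degree d ≥ 1
satisfying e_{-̄1}e₋₁X + f'·X = 0 (i.e. Σ_j T^j ∂_{u_j}(e₋₁X) = f'·X) and having
the same coefficient of u_{d-1}, then P = Q. -/
theorem stmt17 (f : SF) (hf : ContDiff ℝ (⊤ : ℕ∞) f)
    (hli : LinearIndependent ℝ ![f, deriv f])
    (d : ℕ) (hd : 1 ≤ d) (P Q : MvPolynomial ℕ ℝ)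
    (hPv : P.vars ⊆ Finset.range d) (hQv : Q.vars ⊆ Finset.range d)
    (hPh : ∀ m ∈ P.support, wdeg m = d) (hQh : ∀ m ∈ Q.support, wdeg m = d)
    (hPeq : Ebar f (eneg1 (constLift P)) = MvPolynomial.C (deriv f) * constLift P)
    (hQeq : Ebar f (eneg1 (constLift Q)) = MvPolynomial.C (deriv f) * constLift Q)
    (hcoef : MvPolynomial.coeff (Finsupp.single (d - 1) 1) P
      = MvPolynomial.coeff (Finsupp.single (d - 1) 1) Q) :
    P = Q := by
  have hli' : ∀ a b : ℝ, a • f + b • deriv f = 0 → a = 0 ∧ b = 0 :=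
    LinearIndependent.pair_iff.mp hli
  rw [← sub_eq_zero]
  have hAh : ∀ m, coeff m (P - Q) ≠ 0 → wdeg m = d := by
    intro m hm
    by_cases h : coeff m P = 0
    · by_cases h' : coeff m Q = 0
      · rw [coeff_sub, h, h', sub_zero] at hm
        exact absurd rfl hm
      · exact hQh m (mem_support_iff.mpr h')
    · exact hPh m (mem_support_iff.mpr h)
  have hAc : coeff (Finsupp.single (d - 1) 1) (P - Q) = 0 := by
    rw [coeff_sub, hcoef, sub_self]
  obtain ⟨M, hM⟩ := aux_bound (constLift P)
  obtain ⟨M', hM'⟩ := aux_bound (constLift Q)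
  have hp : ∀ k, max M M' ≤ k → pderiv k P = 0 := fun k hk => aux_lift_inj _ _ (by
    rw [← aux_lift_pderiv, hM k (le_trans (le_max_left _ _) hk), map_zero])
  have hq : ∀ k, max M M' ≤ k → pderiv k Q = 0 := fun k hk => aux_lift_inj _ _ (by
    rw [← aux_lift_pderiv, hM' k (le_trans (le_max_right _ _) hk), map_zero])
  have hAE : Ebar f (eneg1 (constLift (P - Q))) = C (deriv f) * constLift (P - Q) := by
    rw [map_sub constLift, mul_sub, ← hPeq, ← hQeq, ← aux_Ebar_sub, aux_eneg_lift P _ hp,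
      aux_eneg_lift Q _ hq, ← map_sub constLift, ← map_sub constLift, aux_eneg_lift (P - Q) (max M M')
        (fun k hk => by rw [map_sub, hp k hk, hq k hk, sub_zero]), ← Finset.sum_sub_distrib]
    simp only [map_sub, mul_sub]
  generalize P - Q = A at *
  by_cases hv : A.vars.Nonempty
  · exfalso
    obtain ⟨N, hN, hfree⟩ := aux_max A hv
    obtain ⟨c, hc⟩ := aux_main f hli' A N hfree hAE
    have hne := aux_pderiv_ne A N hN
    have h1 := congrArg (coeff 0) hc
    rw [coeff_pderiv, zero_add, coeff_zero_C] at h1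
    have hcN : coeff (Finsupp.single N 1) A = c := by simpa using h1
    have hc0 : c ≠ 0 := by
      rintro rfl
      exact hne (by rw [hc, C_0])
    have hw := hAh (Finsupp.single N 1) (by rw [hcN]; exact hc0)
    have hw' : N + 1 = d := by simpa [wdeg] using hw
    subst hw'
    exact hc0 (by rw [← hcN]; simpa using hAc)
  · obtain ⟨c, rfl⟩ := aux_C_of_vars A hv
    by_cases hc : c = 0
    · rw [hc, C_0]
    · have := hAh 0 (by rw [coeff_zero_C]; exact hc)
      simp [wdeg] at this
      omega
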